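/- Proposition 1. There exist p₀ < 1 and finite constants (κ_k, k ≥ 1) with the following property. For any 1-dependent p-site process on the tilted lattice 𝓛 with p ≥ p₀, let T be the smallest even integer T ≥ 2 such that the site (T,0) lies on some doubly-infinite oriented-up good path. Then T is almost surely finite and E[T^k] ≤ κ_k for all k ≥ 1. -/

import Mathlib

open MeasureTheory ProbabilityTheory Set Filter
open scoped ENNReal NNReal

noncomputable section

/-- The site set of the tilted square lattice: pairs `(n₁, n₂)` of integers with
`n₁ + n₂` even. -/
def tiltedSites : Set (ℤ × ℤ) := {v | Even (v.1 + v.2)}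

/-- Adjacency in the tilted square lattice: edges join `(n₁, n₂)` to `(n₁ ± 1, n₂ + 1)`. -/
def tiltedAdj (v w : ℤ × ℤ) : Prop :=
  (w.2 = v.2 + 1 ∧ (w.1 = v.1 + 1 ∨ w.1 = v.1 - 1)) ∨
  (v.2 = w.2 + 1 ∧ (v.1 = w.1 + 1 ∨ v.1 = w.1 - 1))

/-- A 1-dependent `p`-site process on the tilted square lattice: each site is good with
probability `p`, and the families of indicators over two vertex sets with no edge
between them (and no common site) are independent. -/
structure OneDependentSiteProcess (Ω : Type) [MeasurableSpace Ω] (P : Measure Ω)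
    (p : ℝ) where
  good : ℤ × ℤ → Ω → Bool
  meas : ∀ v, Measurable (good v)
  prob : ∀ v ∈ tiltedSites, P {ω | good v ω = true} = ENNReal.ofReal p
  one_dep : ∀ V₁ V₂ : Set (ℤ × ℤ), V₁ ⊆ tiltedSites → V₂ ⊆ tiltedSites →
    Disjoint V₁ V₂ → (∀ v₁ ∈ V₁, ∀ v₂ ∈ V₂, ¬ tiltedAdj v₁ v₂) →
    Indep (⨆ v ∈ V₁, MeasurableSpace.comap (good v) ⊤)
          (⨆ v ∈ V₂, MeasurableSpace.comap (good v) ⊤) P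

/-- The site `s` lies on a doubly-infinite oriented-up good path: a bi-infinite sequence
of sites `(m n, n)` with `m (n+1) = m n ± 1`, all good, passing through `s`. -/
def OnDoublyInfiniteGoodPath {Ω : Type} [MeasurableSpace Ω] {P : Measure Ω} {p : ℝ}
    (X : OneDependentSiteProcess Ω P p) (s : ℤ × ℤ) (ω : Ω) : Prop :=
  ∃ m : ℤ → ℤ, (∀ n, m (n + 1) = m n + 1 ∨ m (n + 1) = m n - 1) ∧
    (∀ n, X.good (m n, n) ω = true) ∧ m s.2 = s.1

/-- The candidate set for `T`: even integers `t ≥ 2` such that `(t, 0)` lies on a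
doubly-infinite oriented-up good path. -/
def Tset {Ω : Type} [MeasurableSpace Ω] {P : Measure Ω} {p : ℝ}
    (X : OneDependentSiteProcess Ω P p) (ω : Ω) : Set ℕ :=
  {t | 2 ≤ t ∧ Even t ∧ OnDoublyInfiniteGoodPath X ((t : ℤ), 0) ω}

/-- `T`: the smallest even integer `T ≥ 2` such that `(T,0)` lies on a doubly-infinite
oriented-up good path (junk value `0` if there is none). -/
def Tvar {Ω : Type} [MeasurableSpace Ω] {P : Measure Ω} {p : ℝ}
    (X : OneDependentSiteProcess Ω P p) (ω : Ω) : ℕ :=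
  sInf (Tset X ω)

/-! ### Deterministic part: contours -/

/-- The bad-site list visited by the contour word, letters: 0 visit, 1 skip, 2 down, 3 up. -/
def visit : List (Fin 4) → ℤ → ℤ → List (ℤ × ℤ)
  | [], _, _ => []
  | 0 :: w, i, y => (i, y) :: visit w (i + 1) y
  | 1 :: w, i, y => visit w (i + 1) y
  | 2 :: w, i, y => visit w i (y - 1)
  | 3 :: w, i, y => visit w (i - 1) (y + 1)

/-- `(i,y)` starts a good downward path with `d` steps (skew coordinates). -/
def lv (c : ℤ × ℤ → Prop) : ℕ → ℤ → ℤ → Prop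
  | 0, i, y => c (i, y)
  | d + 1, i, y => c (i, y) ∧ (lv c d i (y - 1) ∨ lv c d (i + 1) (y - 1))

open Classical in
/-- number of live sites in an interval -/
def cnt (c : ℤ × ℤ → Prop) (d : ℕ) (i y : ℤ) (k : ℕ) : ℕ :=
  ∑ j ∈ Finset.range k, if lv c d (i + j) y then 1 else 0

/-- live downward paths, starting at level `z + d - 1` -/
def Pth (c : ℤ × ℤ → Prop) (z : ℤ) (d : ℕ) (π : ℤ → ℤ) : Prop :=
  (∀ e : ℕ, e < d → lv c e (π (z + e)) (z + e)) ∧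
  ∀ e : ℕ, e + 1 < d → π (z + e) = π (z + e + 1) ∨ π (z + e) = π (z + e + 1) + 1

structure Cl (c : ℤ × ℤ → Prop) (z : ℤ) (d : ℕ) (i : ℤ) (k : ℕ) (w : List (Fin 4))
    (l : List (ℤ × ℤ)) : Prop where
  vis : ∀ w', visit (w ++ w') i (z + d) = l ++ visit w' (i + k) (z + d)
  bad : ∀ e ∈ l, ¬ c e
  nodup : l.Nodup
  len : w.length + 2 * k = 3 * (l.length + cnt c d i (z + d) k)
  le : k ≤ l.length + cnt c d i (z + d) k
  lev : ∀ e ∈ l, e.2 ≤ z + d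
  low : ∀ e ∈ l, z ≤ e.2
  top : ∀ e ∈ l, e.2 = z + d → i ≤ e.1 ∧ e.1 < i + k
  left : ∀ π : ℤ → ℤ, Pth c z d π → π (z + d - 1) ≤ i → ∀ e ∈ l, e.2 < z + d → π e.2 < e.1
  right : ∀ π : ℤ → ℤ, Pth c z d π → i + k ≤ π (z + d - 1) → ∀ e ∈ l, e.2 < z + d →
    e.1 < π e.2

lemma cnt_add (c : ℤ × ℤ → Prop) (d : ℕ) (i y : ℤ) (j k : ℕ) :
    cnt c d i y (j + k) = cnt c d i y j + cnt c d (i + j) y k := by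
  unfold cnt
  rw [Finset.sum_range_add]
  congr 1
  refine Finset.sum_congr rfl fun x _ => ?_
  rw [show i + ((j + x : ℕ) : ℤ) = i + j + x by push_cast; ring]

lemma cnt_zero_of {c : ℤ × ℤ → Prop} {d : ℕ} {i y : ℤ} {k : ℕ}
    (h : ∀ j < k, ¬ lv c d (i + (j : ℕ)) y) : cnt c d i y k = 0 := by
  unfold cnt
  apply Finset.sum_eq_zero
  intro j hj
  simp [h j (Finset.mem_range.1 hj)]

lemma lv_good {c : ℤ × ℤ → Prop} {d : ℕ} {i y : ℤ} (h : lv c d i y) : c (i, y) := by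
  cases d with
  | zero => exact h
  | succ d => exact h.1

lemma Cl.nil (c : ℤ × ℤ → Prop) (z : ℤ) (d : ℕ) (i : ℤ) : Cl c z d i 0 [] [] := by
  constructor <;> simp [cnt]

lemma Cl.single_bad {c : ℤ × ℤ → Prop} {z : ℤ} {d : ℕ} {i : ℤ} (h : ¬ c (i, z + d)) :
    Cl c z d i 1 [0] [(i, z + d)] := by
  have h0 : cnt c d i (z + d) 1 = 0 := by
    apply cnt_zero_of
    intro j hj hl
    have : j = 0 := by omega
    subst this
    apply h
    simpa using lv_good hl
  constructor <;> simp [h0, visit, h]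

lemma Cl.single_live {c : ℤ × ℤ → Prop} {z : ℤ} {d : ℕ} {i : ℤ} (h : lv c d i (z + d)) :
    Cl c z d i 1 [1] [] := by
  have h0 : cnt c d i (z + d) 1 = 1 := by
    unfold cnt
    rw [Finset.sum_range_one]
    simp [h]
  constructor <;> simp [h0, visit]

lemma Cl.append {c : ℤ × ℤ → Prop} {z : ℤ} {d : ℕ} {i : ℤ} {j k : ℕ} {w w' : List (Fin 4)}
    {l l' : List (ℤ × ℤ)} (h : Cl c z d i j w l) (h' : Cl c z d (i + j) k w' l')
    (hd : ∀ e ∈ l, e ∉ l') : Cl c z d i (j + k) (w ++ w') (l ++ l') where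
  vis v := by
    rw [List.append_assoc, h.vis, h'.vis, List.append_assoc]
    push_cast
    rw [add_assoc]
  bad e he := by
    rcases List.mem_append.1 he with he | he
    · exact h.bad e he
    · exact h'.bad e he
  nodup := by
    rw [List.nodup_append']
    exact ⟨h.nodup, h'.nodup, fun e he he' => hd e he he'⟩
  len := by
    have h1 := h.len
    have h2 := h'.len
    rw [cnt_add]
    simp only [List.length_append]
    omega
  le := by
    have h1 := h.le
    have h2 := h'.le
    rw [cnt_add]
    simp only [List.length_append]
    omega
  lev e he := by
    rcases List.mem_append.1 he with he | he
    · exact h.lev e he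
    · exact h'.lev e he
  low e he := by
    rcases List.mem_append.1 he with he | he
    · exact h.low e he
    · exact h'.low e he
  top e he ht := by
    push_cast
    rcases List.mem_append.1 he with he | he
    · have := h.top e he ht
      omega
    · have := h'.top e he ht
      omega
  left π hp hi e he ht := by
    rcases List.mem_append.1 he with he | he
    · exact h.left π hp hi e he ht
    · exact h'.left π hp (by omega) e he ht
  right π hp hi e he ht := by
    push_cast at hi
    rcases List.mem_append.1 he with he | he
    · exact h.right π hp (by omega) e he ht
    · exact h'.right π hp (by omega) e he ht

lemma Pth.pred {c : ℤ × ℤ → Prop} {z : ℤ} {d : ℕ} {π : ℤ → ℤ} (h : Pth c z (d + 1) π) :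
    Pth c z d π :=
  ⟨fun e he => h.1 e (by omega), fun e he => h.2 e (by omega)⟩

/-- A path at level `z+d` with `π (z+d) < i` satisfies the order relation w.r.t. a contour over
`[i,i+k)` at level `z+d`. -/
lemma Cl.left' {c : ℤ × ℤ → Prop} {z : ℤ} {d : ℕ} {i : ℤ} {k : ℕ} {w : List (Fin 4)}
    {l : List (ℤ × ℤ)} (h : Cl c z d i k w l) {π : ℤ → ℤ} (hp : Pth c z (d + 1) π)
    (hi : π (z + d) < i) : ∀ e ∈ l, π e.2 < e.1 := by
  intro e he
  rcases (h.lev e he).lt_or_eq with hl | hl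
  · refine h.left π hp.pred ?_ e he hl
    cases d with
    | zero =>
      have := h.low e he
      push_cast at hl
      omega
    | succ d =>
      have := hp.2 d (by omega)
      push_cast at hi ⊢
      rw [show z + ((d : ℤ) + 1) - 1 = z + d by ring]
      rw [← add_assoc] at hi
      omega
  · have := h.top e he hl
    rw [hl]; omega

lemma Cl.right' {c : ℤ × ℤ → Prop} {z : ℤ} {d : ℕ} {i : ℤ} {k : ℕ} {w : List (Fin 4)}
    {l : List (ℤ × ℤ)} (h : Cl c z d i k w l) {π : ℤ → ℤ} (hp : Pth c z (d + 1) π)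
    (hi : i + k ≤ π (z + d)) : ∀ e ∈ l, e.1 < π e.2 := by
  intro e he
  rcases (h.lev e he).lt_or_eq with hl | hl
  · refine h.right π hp.pred ?_ e he hl
    cases d with
    | zero =>
      have := h.low e he
      push_cast at hl
      omega
    | succ d =>
      have := hp.2 d (by omega)
      push_cast at hi ⊢
      rw [show z + ((d : ℤ) + 1) - 1 = z + d by ring]
      rw [← add_assoc] at hi
      omega
  · have := h.top e he hl
    rw [hl]; omega

lemma Cl.run {c : ℤ × ℤ → Prop} {z : ℤ} {d : ℕ} {i : ℤ} {j : ℕ} {w : List (Fin 4)}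
    {l : List (ℤ × ℤ)} (hA : ∀ j' < j + 1, ¬ lv c d (i + (j' : ℕ)) (z + d)) (hj : 0 < j)
    (h : Cl c z d i (j + 1) w l) : Cl c z (d + 1) i j (2 :: w ++ [3]) l := by
  have h0 := cnt_zero_of hA
  have hz : z + ((d + 1 : ℕ) : ℤ) - 1 = z + d := by push_cast; ring
  have h1 : cnt c (d + 1) i (z + (d + 1 : ℕ)) j = 0 := by
    apply cnt_zero_of
    intro j' hj' hl
    have h2 := hl.2
    rw [hz] at h2
    rcases h2 with h2 | h2
    · exact hA j' (by omega) h2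
    · apply hA (j' + 1) (by omega)
      push_cast
      rwa [← add_assoc]
  have hlen := h.len
  have hle := h.le
  rw [h0] at hlen hle
  refine ⟨?_, h.bad, h.nodup, ?_, ?_, ?_, h.low, ?_, ?_, ?_⟩
  · intro w'
    have := h.vis (3 :: w')
    simp only [List.cons_append, List.append_assoc, List.nil_append, visit, hz] at this ⊢
    rw [this]
    congr 2 <;> push_cast <;> ring
  · rw [h1]
    simp only [List.length_append, List.length_cons, List.length_nil]
    omega
  · rw [h1]; omega
  · intro e he
    have := h.lev e he
    push_cast
    omega
  · intro e he he2
    have := h.lev e he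
    push_cast at he2
    omega
  · intro π hp hi e he _
    rw [hz] at hi
    refine h.left' hp ?_ e he
    have h3 := hp.1 d (by omega)
    have h4 := hA 0 (by omega)
    rcases hi.lt_or_eq with h5 | h5
    · exact h5
    · rw [h5] at h3
      simp at h4
      exact absurd h3 h4
  · intro π hp hi e he _
    rw [hz] at hi
    refine h.right' hp ?_ e he
    have h3 := hp.1 d (by omega)
    have h4 := hA j (by omega)
    rcases hi.lt_or_eq with h5 | h5
    · push_cast; omega
    · rw [← h5] at h3
      exact absurd h3 h4

lemma exists_Pth {c : ℤ × ℤ → Prop} {z : ℤ} : ∀ {d : ℕ} {b : ℤ}, lv c d b (z + d) →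
    ∃ π : ℤ → ℤ, Pth c z (d + 1) π ∧ π (z + d) = b := by
  intro d
  induction d with
  | zero =>
    intro b h
    refine ⟨fun _ => b, ⟨?_, ?_⟩, rfl⟩
    · intro e he
      have : e = 0 := by omega
      subst this
      exact h
    · intro e he
      omega
  | succ d ih =>
    intro b h
    have h2 := h.2
    have hz : z + ((d + 1 : ℕ) : ℤ) - 1 = z + d := by push_cast; ring
    rw [hz] at h2
    obtain ⟨b', hb', hl⟩ : ∃ b', (b' = b ∨ b' = b + 1) ∧ lv c d b' (z + d) := by
      rcases h2 with h2 | h2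
      · exact ⟨b, Or.inl rfl, h2⟩
      · exact ⟨b + 1, Or.inr rfl, h2⟩
    obtain ⟨π, hp, hb⟩ := ih hl
    have hne : ∀ e : ℕ, e < d + 1 → z + (e : ℤ) ≠ z + ((d + 1 : ℕ) : ℤ) := by
      intro e he
      push_cast
      omega
    refine ⟨Function.update π (z + (d + 1 : ℕ)) b, ⟨?_, ?_⟩, by simp⟩
    · intro e he
      by_cases hed : e = d + 1
      · subst hed
        simpa using h
      · rw [Function.update_of_ne (hne e (by omega))]
        exact hp.1 e (by omega)
    · intro e he
      rw [Function.update_of_ne (hne e (by omega))]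
      by_cases hed : e = d
      · subst hed
        rw [show z + (e : ℤ) + 1 = z + ((e + 1 : ℕ) : ℤ) by push_cast; ring,
          Function.update_self, hb]
        exact hb'
      · rw [show z + (e : ℤ) + 1 = z + ((e + 1 : ℕ) : ℤ) by push_cast; ring,
          Function.update_of_ne (hne (e + 1) (by omega))]
        have := hp.2 e (by omega)
        rw [show z + (e : ℤ) + 1 = z + ((e + 1 : ℕ) : ℤ) by push_cast; ring] at this
        exact this

lemma exists_first (A : ℕ → Prop) (k : ℕ) :
    ∃ j ≤ k, (∀ j' < j, A j') ∧ (j < k → ¬ A j) := by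
  induction k with
  | zero => exact ⟨0, le_rfl, by simp, by simp⟩
  | succ k ih =>
    obtain ⟨j, hj, h1, h2⟩ := ih
    rcases hj.lt_or_eq with h | h
    · exact ⟨j, by omega, h1, fun _ => h2 h⟩
    · subst h
      by_cases hA : A j
      · refine ⟨j + 1, le_rfl, ?_, by omega⟩
        intro j' hj'
        by_cases h3 : j' = j
        · subst h3; exact hA
        · exact h1 j' (by omega)
      · exact ⟨j, by omega, h1, fun _ => hA⟩

/-- single site, either live or bad -/
lemma exists_single {c : ℤ × ℤ → Prop} {z : ℤ} {d : ℕ} {i : ℤ}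
    (h : lv c d i (z + d) ∨ ¬ c (i, z + d)) :
    ∃ w l, Cl c z d i 1 w l ∧ ∀ e ∈ l, e.2 = z + d := by
  rcases h with h | h
  · exact ⟨_, _, Cl.single_live h, by simp⟩
  · exact ⟨_, _, Cl.single_bad h, by simp⟩

lemma exists_cons {c : ℤ × ℤ → Prop} {z : ℤ} {d : ℕ} {i : ℤ} {k : ℕ}
    (h : lv c d i (z + d) ∨ ¬ c (i, z + d)) {w : List (Fin 4)} {l : List (ℤ × ℤ)}
    (hc : Cl c z d (i + 1) k w l) :
    ∃ w' l', Cl c z d i (1 + k) w' l' ∧ ∀ e ∈ l', e.2 = z + d ∨ e ∈ l := by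
  obtain ⟨w1, l1, h1, ht⟩ := exists_single h
  refine ⟨w1 ++ w, l1 ++ l, h1.append (by simpa using hc) ?_, ?_⟩
  · intro e he he'
    have a1 := h1.top e he (ht e he)
    have a2 := hc.top e he' (ht e he)
    push_cast at a1
    omega
  · intro e he
    rcases List.mem_append.1 he with he | he
    · exact Or.inl (ht e he)
    · exact Or.inr he

lemma exists_Cl (c : ℤ × ℤ → Prop) (z : ℤ) : ∀ (d k : ℕ) (i : ℤ), ∃ w l, Cl c z d i k w l := by
  intro d
  induction d with
  | zero =>
    intro k
    induction k with
    | zero => intro i; exact ⟨_, _, Cl.nil c z 0 i⟩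
    | succ k ih =>
      intro i
      obtain ⟨w, l, h⟩ := ih (i + 1)
      obtain ⟨w', l', h', -⟩ := exists_cons (i := i) (by
        simp only [lv]; exact Classical.em _) h
      rw [add_comm] at h'
      exact ⟨w', l', h'⟩
  | succ d ihd =>
    intro k
    induction k using Nat.strong_induction_on with
    | _ k ih =>
    intro i
    have hz : z + ((d + 1 : ℕ) : ℤ) - 1 = z + d := by push_cast; ring
    obtain ⟨j, hjk, hA, hB⟩ := exists_first
      (fun j => ¬ lv c d (i + (j : ℕ)) (z + d) ∧ ¬ lv c d (i + (j : ℕ) + 1) (z + d)) k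
    have hrun : ∃ w l, Cl c z (d + 1) i j w l ∧ (∀ e ∈ l, e.2 ≤ z + d) ∧
        (j = 0 → l = []) ∧ (0 < j → ¬ lv c d (i + j) (z + d)) ∧
        ∀ π, Pth c z (d + 1) π → i + j + 1 ≤ π (z + d) → ∀ e ∈ l, e.1 < π e.2 := by
      rcases Nat.eq_zero_or_pos j with h0 | h0
      · subst h0
        exact ⟨_, _, Cl.nil c z (d + 1) i, by simp, by simp, by simp, by simp⟩
      · obtain ⟨w, l, h⟩ := ihd (j + 1) i
        have hA' : ∀ j' < j + 1, ¬ lv c d (i + (j' : ℕ)) (z + d) := by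
          intro j' hj'
          by_cases h3 : j' = j
          · subst h3
            have := (hA (j' - 1) (by omega)).2
            rwa [show i + ((j' - 1 : ℕ) : ℤ) + 1 = i + j' by omega] at this
          · exact (hA j' (by omega)).1
        refine ⟨_, l, h.run hA' h0, h.lev, by omega, fun _ => hA' j (by omega), ?_⟩
        intro π hp hi
        exact h.right' hp (by push_cast; omega)
    obtain ⟨w, l, h, hlev, hnil, hdead, hright⟩ := hrun
    rcases hjk.lt_or_eq with hlt | heq
    · obtain ⟨wr, lr, hr⟩ := ih (k - j - 1) (by omega) (i + j + 1)
      have hBj := hB hlt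
      obtain ⟨w', l', h', hl'⟩ := exists_cons (i := i + j) (by
        by_cases hg : c (i + j, z + (d + 1 : ℕ))
        · left
          refine ⟨hg, ?_⟩
          rw [hz]
          by_contra hcon
          rw [not_or] at hcon
          exact hBj hcon
        · right; exact hg) hr
      have happ := h.append h' (by
        intro e he he'
        have e1 := hlev e he
        rcases hl' e he' with h3 | h3
        · push_cast at h3
          omega
        · rcases Nat.eq_zero_or_pos j with h0 | h0
          · rw [hnil h0] at he
            simp at he
          · have hlive : lv c d (i + j + 1) (z + d) := by
              by_contra hcon
              exact hBj ⟨hdead h0, hcon⟩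
            obtain ⟨π, hp, hb⟩ := exists_Pth hlive
            have a1 := hright π hp hb.ge e he
            have a2 := hr.left π hp (by rw [hz, hb]) e h3 (by push_cast; omega)
            omega)
      rw [show j + (1 + (k - j - 1)) = k by omega] at happ
      exact ⟨_, _, happ⟩
    · subst heq
      exact ⟨w, l, h⟩

lemma visit_replicate (n : ℕ) : ∀ i y, visit (List.replicate n 2) i y = [] := by
  induction n with
  | zero => intro i y; rfl
  | succ n ih => intro i y; rw [List.replicate_succ]; simp only [visit]; exact ih _ _

lemma cnt_le (c : ℤ × ℤ → Prop) (d : ℕ) (i y : ℤ) (k : ℕ) : cnt c d i y k ≤ k := by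
  unfold cnt
  calc _ ≤ ∑ j ∈ Finset.range k, 1 := Finset.sum_le_sum fun j _ => by split_ifs <;> simp
    _ = k := by simp

lemma contour (c : ℤ × ℤ → Prop) (N L : ℕ) (i : ℤ) (h : 2 * cnt c L i 0 N ≤ N) :
    ∃ m, N ≤ 2 * m ∧ ∃ w : Fin (5 * m) → Fin 4, (visit (List.ofFn w) i 0).length = m ∧
      (visit (List.ofFn w) i 0).Nodup ∧ ∀ e ∈ visit (List.ofFn w) i 0, ¬ c e := by
  obtain ⟨w, l, hc⟩ := exists_Cl c (-(L : ℤ)) L N i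
  have hlen := hc.len
  have hle := hc.le
  have hvis := hc.vis
  have hs := cnt_le c L i 0 N
  simp only [neg_add_cancel] at hlen hle hvis
  refine ⟨l.length, by omega, ?_⟩
  set w2 := w ++ List.replicate (5 * l.length - w.length) 2 with hw2
  have hw2l : w2.length = 5 * l.length := by
    rw [hw2]
    simp only [List.length_append, List.length_replicate]
    omega
  have hv : visit w2 i 0 = l := by
    rw [hw2, hvis, visit_replicate, List.append_nil]
  have hof : List.ofFn (fun a : Fin (5 * l.length) => w2[a]) = w2 := by
    apply List.ext_getElem
    · simp [hw2l]
    · intro n h1 h2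
      simp
  refine ⟨fun a => w2[a], ?_⟩
  rw [hof, hv]
  exact ⟨rfl, hc.nodup, hc.bad⟩

/-! ### Probability part -/

lemma prob_bad_parity {Ω : Type} [MeasurableSpace Ω] {P : Measure Ω} [IsProbabilityMeasure P]
    {p : ℝ} (X : OneDependentSiteProcess Ω P p) {q : ℝ≥0∞} (hq : 1 - ENNReal.ofReal p ≤ q)
    (a : ℤ) (E : Finset (ℤ × ℤ)) (hE : ∀ v ∈ E, v ∈ tiltedSites ∧ v.2 % 2 = a) :
    P {ω | ∀ v ∈ E, X.good v ω = false} ≤ q ^ E.card := by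
  classical
  induction E using Finset.induction_on with
  | empty => simp
  | insert v E hv ih =>
    have ih' := ih (fun u hu => hE u (Finset.mem_insert_of_mem hu))
    have hvt := hE v (Finset.mem_insert_self _ _)
    have hind := X.one_dep {v} (E : Set (ℤ × ℤ)) (by simpa using hvt.1)
      (fun u hu => (hE u (Finset.mem_insert_of_mem hu)).1) (by simpa using hv) (by
        intro u hu u' hu' hadj
        have hu : u = v := hu
        subst hu
        have h2 := (hE u' (Finset.mem_insert_of_mem hu')).2
        have h1 := hvt.2
        rcases hadj with h | h <;> omega)
    have hmv : ∀ (V : Set (ℤ × ℤ)) (u), u ∈ V →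
        MeasurableSet[⨆ v ∈ V, MeasurableSpace.comap (X.good v) ⊤] {ω | X.good u ω = false} := by
      intro V u hu
      have hle : MeasurableSpace.comap (X.good u) ⊤ ≤
          ⨆ v ∈ V, MeasurableSpace.comap (X.good v) ⊤ :=
        le_iSup₂ (f := fun v (_ : v ∈ V) => MeasurableSpace.comap (X.good v) ⊤) u hu
      exact hle _ ⟨{false}, trivial, rfl⟩
    have hset : {ω | ∀ u ∈ insert v E, X.good u ω = false} =
        {ω | X.good v ω = false} ∩ {ω | ∀ u ∈ E, X.good u ω = false} := by
      ext ω; simp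
    have hset2 : {ω | ∀ u ∈ E, X.good u ω = false} = ⋂ u ∈ E, {ω | X.good u ω = false} := by
      ext ω; simp
    rw [hset, (Indep_iff _ _ _).1 hind _ _ (hmv _ v rfl) (by
      rw [hset2]
      exact Finset.measurableSet_biInter _ fun u hu => hmv _ u hu),
      Finset.card_insert_of_notMem hv, pow_succ']
    refine mul_le_mul' ?_ ih'
    have hc : {ω | X.good v ω = false} = {ω | X.good v ω = true}ᶜ := by
      ext ω; simp
    have hms : MeasurableSet {ω | X.good v ω = true} := X.meas v (measurableSet_singleton true)
    rw [hc, prob_compl_eq_one_sub hms, X.prob v hvt.1]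
    exact hq

lemma prob_bad {Ω : Type} [MeasurableSpace Ω] {P : Measure Ω} [IsProbabilityMeasure P]
    {p : ℝ} (X : OneDependentSiteProcess Ω P p) {r : ℝ≥0∞} (hr : r ≤ 1)
    (hq : 1 - ENNReal.ofReal p ≤ r ^ 2)
    (E : Finset (ℤ × ℤ)) (hE : ∀ v ∈ E, v ∈ tiltedSites) :
    P {ω | ∀ v ∈ E, X.good v ω = false} ≤ r ^ E.card := by
  classical
  have key : ∀ F ⊆ E, ∀ a : ℤ, (∀ v ∈ F, v.2 % 2 = a) → E.card ≤ 2 * F.card →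
      P {ω | ∀ v ∈ E, X.good v ω = false} ≤ r ^ E.card := by
    intro F hF a ha hcard
    calc P {ω | ∀ v ∈ E, X.good v ω = false} ≤ P {ω | ∀ v ∈ F, X.good v ω = false} :=
          measure_mono fun ω hω v hv => hω v (hF hv)
      _ ≤ (r ^ 2) ^ F.card := prob_bad_parity X hq a F fun v hv => ⟨hE v (hF hv), ha v hv⟩
      _ = r ^ (2 * F.card) := by rw [pow_mul]
      _ ≤ r ^ E.card := pow_le_pow_right_of_le_one' hr hcard
  have hsum := Finset.card_filter_add_card_filter_not (s := E) (fun v : ℤ × ℤ => v.2 % 2 = 0)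
  by_cases h : E.card ≤ 2 * (E.filter (fun v : ℤ × ℤ => v.2 % 2 = 0)).card
  · refine key _ (Finset.filter_subset _ _) 0 ?_ h
    intro v hv
    exact (Finset.mem_filter.1 hv).2
  · refine key (E.filter (fun v : ℤ × ℤ => ¬ v.2 % 2 = 0)) (Finset.filter_subset _ _) 1 ?_
      (by omega)
    intro v hv
    have := (Finset.mem_filter.1 hv).2
    omega

lemma prob_dead {Ω : Type} [MeasurableSpace Ω] {P : Measure Ω} [IsProbabilityMeasure P]
    {p : ℝ} (X : OneDependentSiteProcess Ω P p)
    (hq : 1 - ENNReal.ofReal p ≤ ((8192 : ℝ≥0∞)⁻¹) ^ 2) (σ : ℤ × ℤ → ℤ × ℤ)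
    (hσ : Function.Injective σ) (hσt : ∀ e, σ e ∈ tiltedSites) (N L : ℕ) :
    P {ω | 2 * cnt (fun e => X.good (σ e) ω = true) L 1 0 N ≤ N} ≤ 2 * (2⁻¹) ^ N := by
  classical
  set S : (m : ℕ) → (Fin (5 * m) → Fin 4) → Set Ω := fun m w =>
    {ω | N ≤ 2 * m ∧ (visit (List.ofFn w) 1 0).length = m ∧
      (visit (List.ofFn w) 1 0).Nodup ∧
      ∀ e ∈ visit (List.ofFn w) 1 0, ¬ X.good (σ e) ω = true} with hS
  have hsub : {ω | 2 * cnt (fun e => X.good (σ e) ω = true) L 1 0 N ≤ N} ⊆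
      ⋃ m, ⋃ w, S m w := by
    intro ω hω
    obtain ⟨m, hm, w, h1, h2, h3⟩ := contour _ N L 1 hω
    simp only [mem_iUnion]
    exact ⟨m, w, hm, h1, h2, h3⟩
  have hSb : ∀ m w, N ≤ 2 * m → P (S m w) ≤ ((8192 : ℝ≥0∞)⁻¹) ^ m := by
    intro m w hm
    by_cases hl : (visit (List.ofFn w) 1 0).length = m ∧ (visit (List.ofFn w) 1 0).Nodup
    · set E := (visit (List.ofFn w) 1 0).toFinset.image σ with hEdef
      have hcard : E.card = m := by
        rw [hEdef, Finset.card_image_of_injective _ hσ, List.toFinset_card_of_nodup hl.2, hl.1]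
      have := prob_bad X (r := (8192 : ℝ≥0∞)⁻¹) (by simp) hq E (by
        intro v hv
        obtain ⟨e, -, rfl⟩ := Finset.mem_image.1 hv
        exact hσt e)
      rw [hcard] at this
      refine le_trans (measure_mono ?_) this
      intro ω hω v hv
      obtain ⟨e, he, rfl⟩ := Finset.mem_image.1 hv
      simpa using hω.2.2.2 e (List.mem_toFinset.1 he)
    · have : S m w = ∅ := by
        ext ω
        simp only [hS, mem_ofPred_eq, mem_empty_iff_false, iff_false]
        rintro ⟨-, h1, h2, -⟩
        exact hl ⟨h1, h2⟩
      rw [this]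
      simp
  have hm : ∀ m, P (⋃ w, S m w) ≤ (2⁻¹) ^ N * (2⁻¹) ^ m := by
    intro m
    by_cases hN : N ≤ 2 * m
    · calc P (⋃ w, S m w) ≤ ∑' w, P (S m w) := measure_iUnion_le _
        _ = ∑ w, P (S m w) := tsum_fintype _
        _ ≤ ∑ w : Fin (5 * m) → Fin 4, ((8192 : ℝ≥0∞)⁻¹) ^ m :=
            Finset.sum_le_sum fun w _ => hSb m w hN
        _ = (1024 : ℝ≥0∞) ^ m * ((8192 : ℝ≥0∞)⁻¹) ^ m := by
            simp [pow_mul]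
        _ = ((2⁻¹ : ℝ≥0∞)) ^ (3 * m) := by
            rw [← mul_pow, pow_mul]
            congr 1
            rw [show (8192 : ℝ≥0∞) = 1024 * 8 by norm_num,
              ENNReal.mul_inv (by simp) (by simp), ← mul_assoc,
              ENNReal.mul_inv_cancel (by simp) (by simp), one_mul, ENNReal.inv_pow.symm]
            norm_num
        _ = (2⁻¹) ^ (2 * m) * (2⁻¹) ^ m := by rw [← pow_add]; congr 1; ring
        _ ≤ _ := by
            gcongr ?_ * _
            exact pow_le_pow_right_of_le_one' (by simp) hN
    · have : ⋃ w, S m w = ∅ := by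
        ext ω
        simp only [hS, mem_iUnion, mem_ofPred_eq, mem_empty_iff_false, iff_false]
        rintro ⟨w, h1, -⟩
        exact hN h1
      rw [this]
      simp
  calc _ ≤ P (⋃ m, ⋃ w, S m w) := measure_mono hsub
    _ ≤ ∑' m, P (⋃ w, S m w) := measure_iUnion_le _
    _ ≤ ∑' m, (2⁻¹) ^ N * (2⁻¹) ^ m := ENNReal.tsum_le_tsum hm
    _ = 2 * (2⁻¹) ^ N := by
      rw [ENNReal.tsum_mul_left, ENNReal.tsum_geometric, ENNReal.one_sub_inv_two, inv_inv,
        mul_comm]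

/-! ### Infinite paths -/

lemma lv_pred {c : ℤ × ℤ → Prop} : ∀ {d : ℕ} {i y : ℤ}, lv c (d + 1) i y → lv c d i y := by
  intro d
  induction d with
  | zero => intro i y h; exact h.1
  | succ d ih =>
    intro i y h
    exact ⟨h.1, h.2.imp ih ih⟩

lemma lv_anti {c : ℤ × ℤ → Prop} {d e : ℕ} (hde : d ≤ e) {i y : ℤ} (h : lv c e i y) :
    lv c d i y := by
  induction e, hde using Nat.le_induction with
  | base => exact h
  | succ e _ ih => exact ih (lv_pred h)

lemma cnt_anti (c : ℤ × ℤ → Prop) {d e : ℕ} (hde : d ≤ e) (i y : ℤ) (k : ℕ) :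
    cnt c e i y k ≤ cnt c d i y k := by
  unfold cnt
  refine Finset.sum_le_sum fun j _ => ?_
  by_cases h : lv c e (i + j) y
  · simp [h, lv_anti hde h]
  · simp [h]

lemma inf_step {c : ℤ × ℤ → Prop} {i y : ℤ} (h : ∀ d, lv c d i y) :
    ∃ i', (i' = i ∨ i' = i + 1) ∧ ∀ d, lv c d i' (y - 1) := by
  by_contra hcon
  push Not at hcon
  obtain ⟨d1, h1⟩ := hcon i (Or.inl rfl)
  obtain ⟨d2, h2⟩ := hcon (i + 1) (Or.inr rfl)
  rcases (h (max d1 d2 + 1)).2 with h3 | h3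
  · exact h1 (lv_anti (le_max_left _ _) h3)
  · exact h2 (lv_anti (le_max_right _ _) h3)

lemma inf_path {c : ℤ × ℤ → Prop} {i : ℤ} (h : ∀ d, lv c d i 0) :
    ∃ π : ℕ → ℤ, π 0 = i ∧ (∀ t, π (t + 1) = π t ∨ π (t + 1) = π t + 1) ∧
      ∀ t : ℕ, c (π t, -(t : ℤ)) := by
  choose! f hf1 hf2 using fun (i y : ℤ) (h : ∀ d, lv c d i y) => inf_step h
  let π : ℕ → ℤ := fun t => Nat.rec i (fun t a => f a (-(t : ℤ))) t
  have hs : ∀ t, π (t + 1) = f (π t) (-(t : ℤ)) := fun t => rfl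
  have hl : ∀ t : ℕ, ∀ d, lv c d (π t) (-(t : ℤ)) := by
    intro t
    induction t with
    | zero => simpa [π] using h
    | succ t ih =>
      rw [hs]
      have := hf2 _ _ ih
      intro d
      have := this d
      push_cast
      rwa [neg_add, ← sub_eq_add_neg]
  refine ⟨π, rfl, fun t => ?_, fun t => hl t 0⟩
  rw [hs]
  exact hf1 _ _ (hl t)

/-- skew embeddings -/
def sdown (e : ℤ × ℤ) : ℤ × ℤ := (2 * e.1 + e.2, e.2)
def sup' (e : ℤ × ℤ) : ℤ × ℤ := (2 * e.1 + e.2, -e.2)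

lemma sdown_inj : Function.Injective sdown := by
  rintro ⟨a, b⟩ ⟨a', b'⟩ h
  simp only [sdown, Prod.mk.injEq] at h ⊢
  omega
lemma sup'_inj : Function.Injective sup' := by
  rintro ⟨a, b⟩ ⟨a', b'⟩ h
  simp only [sup', Prod.mk.injEq] at h ⊢
  omega
lemma sdown_mem (e : ℤ × ℤ) : sdown e ∈ tiltedSites := ⟨e.1 + e.2, by simp [sdown]; ring⟩
lemma sup'_mem (e : ℤ × ℤ) : sup' e ∈ tiltedSites := ⟨e.1, by simp [sup']; ring⟩

lemma double_path {Ω : Type} [MeasurableSpace Ω] {P : Measure Ω}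
    {p : ℝ} (X : OneDependentSiteProcess Ω P p) (ω : Ω) (i : ℤ)
    (h1 : ∀ d, lv (fun e => X.good (sdown e) ω = true) d i 0)
    (h2 : ∀ d, lv (fun e => X.good (sup' e) ω = true) d i 0) :
    OnDoublyInfiniteGoodPath X (2 * i, 0) ω := by
  obtain ⟨π, hπ0, hπs, hπ⟩ := inf_path h1
  obtain ⟨ρ, hρ0, hρs, hρ⟩ := inf_path h2
  refine ⟨fun n => if 0 ≤ n then 2 * ρ n.toNat - n else 2 * π (-n).toNat + n, ?_, ?_, ?_⟩
  · intro n
    rcases lt_trichotomy n (-1) with hn | hn | hn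
    · have e : (-n).toNat = (-(n + 1)).toNat + 1 := by omega
      have := hπs (-(n + 1)).toNat
      rw [← e] at this
      simp only [show ¬ (0 ≤ n + 1) by omega, show ¬ (0 ≤ n) by omega, if_false]
      omega
    · subst hn
      have := hπs 0
      simp
      simp at this
      omega
    · have e : (n + 1).toNat = n.toNat + 1 := by omega
      have := hρs n.toNat
      rw [← e] at this
      simp only [show (0 ≤ n + 1) by omega, show (0 ≤ n) by omega, if_true]
      omega
  · intro n
    by_cases hn : 0 ≤ n
    · have := hρ n.toNat
      simp only [hn, if_true]
      simp only [sup', Int.toNat_of_nonneg hn, neg_neg] at this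
      exact this
    · have := hπ (-n).toNat
      simp only [hn, if_false]
      simp only [sdown, Int.toNat_of_nonneg (show 0 ≤ -n by omega), neg_neg] at this
      exact this
  · simp [hρ0]

/-- no site of the window is on a doubly infinite path -/
def Aset {Ω : Type} [MeasurableSpace Ω] {P : Measure Ω} {p : ℝ}
    (X : OneDependentSiteProcess Ω P p) (N : ℕ) : Set Ω :=
  {ω | ∀ t ∈ Tset X ω, 2 * N < t}

lemma exists_cnt {c : ℤ × ℤ → Prop} (i : ℤ) (N : ℕ) (S : Finset ℕ) (hS : S ⊆ Finset.range N)
    (h : ∀ j ∈ S, ∃ d, ¬ lv c d (i + (j : ℕ)) 0) : ∃ d, cnt c d i 0 N + S.card ≤ N := by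
  classical
  choose! f hf using h
  refine ⟨S.sup f, ?_⟩
  have hsub : (Finset.range N).filter (fun j : ℕ => lv c (S.sup f) (i + j) 0) ⊆
      Finset.range N \ S := by
    intro j hj
    rw [Finset.mem_filter] at hj
    rw [Finset.mem_sdiff]
    exact ⟨hj.1, fun hjS => hf j hjS (lv_anti (Finset.le_sup hjS) hj.2)⟩
  have h1 := Finset.card_le_card hsub
  rw [Finset.card_sdiff_of_subset hS, Finset.card_range] at h1
  have h2 := Finset.card_le_card hS
  rw [Finset.card_range] at h2
  have h3 : cnt c (S.sup f) i 0 N =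
      ((Finset.range N).filter (fun j : ℕ => lv c (S.sup f) (i + j) 0)).card := by
    unfold cnt
    rw [Finset.card_filter]
  omega

lemma prob_A {Ω : Type} [MeasurableSpace Ω] {P : Measure Ω} [IsProbabilityMeasure P]
    {p : ℝ} (X : OneDependentSiteProcess Ω P p)
    (hq : 1 - ENNReal.ofReal p ≤ ((8192 : ℝ≥0∞)⁻¹) ^ 2) (N : ℕ) :
    P (Aset X N) ≤ 4 * (2⁻¹) ^ N := by
  classical
  set F : (ℤ × ℤ → ℤ × ℤ) → ℕ → Set Ω := fun σ L =>
    {ω | 2 * cnt (fun e => X.good (σ e) ω = true) L 1 0 N ≤ N} with hF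
  have hFm : ∀ σ, Monotone (F σ) := by
    intro σ L L' hL ω hω
    have := cnt_anti (fun e => X.good (σ e) ω = true) hL 1 0 N
    simp only [hF, mem_ofPred_eq] at hω ⊢
    omega
  have hFb : ∀ σ, Function.Injective σ → (∀ e, σ e ∈ tiltedSites) →
      P (⋃ L, F σ L) ≤ 2 * (2⁻¹) ^ N := by
    intro σ h1 h2
    rw [(hFm σ).measure_iUnion]
    exact iSup_le fun L => prob_dead X hq σ h1 h2 N L
  have hsub : Aset X N ⊆ (⋃ L, F sdown L) ∪ ⋃ L, F sup' L := by
    intro ω hω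
    set c1 : ℤ × ℤ → Prop := fun e => X.good (sdown e) ω = true with hc1
    set c2 : ℤ × ℤ → Prop := fun e => X.good (sup' e) ω = true with hc2
    set S1 := (Finset.range N).filter (fun j : ℕ => ∃ d, ¬ lv c1 d (1 + j) 0) with hS1
    set S2 := (Finset.range N).filter (fun j : ℕ => ∃ d, ¬ lv c2 d (1 + j) 0) with hS2
    have hcov : Finset.range N ⊆ S1 ∪ S2 := by
      intro j hj
      by_contra hcon
      simp only [hS1, hS2, Finset.mem_union, Finset.mem_filter, hj, true_and, not_or, not_exists,
        not_not] at hcon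
      have hp := double_path X ω (1 + j) hcon.1 hcon.2
      have hT : 2 * (j + 1) ∈ Tset X ω := by
        refine ⟨by omega, by simp, ?_⟩
        convert hp using 2
        push_cast
        ring
      have := hω _ hT
      have := Finset.mem_range.1 hj
      omega
    have hcard := (Finset.card_le_card hcov).trans (Finset.card_union_le _ _)
    rw [Finset.card_range] at hcard
    obtain ⟨d1, h1⟩ := exists_cnt 1 N S1 (Finset.filter_subset _ _)
      (fun j hj => (Finset.mem_filter.1 hj).2)
    obtain ⟨d2, h2⟩ := exists_cnt 1 N S2 (Finset.filter_subset _ _)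
      (fun j hj => (Finset.mem_filter.1 hj).2)
    by_cases h : 2 * cnt c1 d1 1 0 N ≤ N
    · left
      exact mem_iUnion.2 ⟨d1, h⟩
    · right
      refine mem_iUnion.2 ⟨d2, ?_⟩
      change 2 * cnt c2 d2 1 0 N ≤ N
      omega
  calc P (Aset X N) ≤ _ := measure_mono hsub
    _ ≤ _ := measure_union_le _ _
    _ ≤ 2 * (2⁻¹) ^ N + 2 * (2⁻¹) ^ N :=
      add_le_add (hFb _ sdown_inj sdown_mem) (hFb _ sup'_inj sup'_mem)
    _ = _ := by ring

/-- the constants -/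
def kap (k : ℕ) : ℝ≥0∞ := ∑' N : ℕ, ((2 * N + 2 : ℕ) : ℝ≥0∞) ^ k * (4 * (2⁻¹) ^ N)

lemma kap_lt (k : ℕ) : kap k < ⊤ := by
  have hs : Summable (fun N : ℕ => ((2 * N + 2 : ℕ) : ℝ) ^ k * (4 * (2⁻¹ : ℝ) ^ N)) := by
    have h := summable_pow_mul_geometric_of_norm_lt_one (R := ℝ) k (r := 2⁻¹) (by norm_num)
    have h2 := ((summable_nat_add_iff 1).2 h).mul_left ((2 : ℝ) ^ k * 8)
    refine h2.congr fun N => ?_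
    push_cast
    rw [show (2 * (N : ℝ) + 2) = 2 * (N + 1) by ring, mul_pow, pow_succ]
    ring
  have : kap k = ENNReal.ofReal (∑' N : ℕ, ((2 * N + 2 : ℕ) : ℝ) ^ k * (4 * (2⁻¹ : ℝ) ^ N)) := by
    rw [ENNReal.ofReal_tsum_of_nonneg (fun N => by positivity) hs]
    unfold kap
    congr 1
    ext1 N
    rw [ENNReal.ofReal_mul (by positivity), ENNReal.ofReal_mul (by positivity),
      ENNReal.ofReal_pow (by positivity), ENNReal.ofReal_pow (by positivity),
      ENNReal.ofReal_natCast, ENNReal.ofReal_inv_of_pos (by norm_num)]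
    simp
  rw [this]
  exact ENNReal.ofReal_lt_top

/-- **Proposition 1.** There exist `p₀ < 1` and finite constants `κ_k` such that for any
1-dependent `p`-site process with `p₀ ≤ p < 1`, the variable `T` is almost surely
well-defined (and finite) and `E[T^k] ≤ κ_k` for all `k ≥ 1`. -/
theorem proposition1 :
    ∃ p₀ : ℝ, p₀ < 1 ∧ ∃ κ : ℕ → ℝ≥0∞, (∀ k, κ k < ⊤) ∧
      ∀ (Ω : Type) (_ : MeasurableSpace Ω) (P : Measure Ω) (_ : IsProbabilityMeasure P)
        (p : ℝ) (X : OneDependentSiteProcess Ω P p), p₀ ≤ p → p < 1 →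
          (∀ᵐ ω ∂P, (Tset X ω).Nonempty) ∧
          ∀ k : ℕ, 1 ≤ k → (∫⁻ ω, (Tvar X ω : ℝ≥0∞) ^ k ∂P) ≤ κ k := by
  refine ⟨1 - (1 / 8192) ^ 2, by norm_num, kap, kap_lt, ?_⟩
  intro Ω _ P _ p X hp _
  have hq : 1 - ENNReal.ofReal p ≤ ((8192 : ℝ≥0∞)⁻¹) ^ 2 := by
    rw [tsub_le_iff_right]
    have h1 : ((8192 : ℝ≥0∞)⁻¹) ^ 2 = ENNReal.ofReal ((1 / 8192) ^ 2) := by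
      rw [ENNReal.ofReal_pow (by norm_num), one_div, ENNReal.ofReal_inv_of_pos (by norm_num)]
      simp
    rw [h1, ← ENNReal.ofReal_add (by norm_num) (le_trans (by norm_num) hp),
      ENNReal.one_le_ofReal]
    linarith
  have hA := prob_A X hq
  refine ⟨?_, ?_⟩
  · rw [ae_iff]
    have hb : ∀ N : ℕ, P {ω | ¬ (Tset X ω).Nonempty} ≤ 4 * (2⁻¹) ^ N := by
      intro N
      refine (measure_mono ?_).trans (hA N)
      intro ω hω t ht
      exact absurd ⟨t, ht⟩ hω
    have ht : Tendsto (fun N : ℕ => 4 * (2⁻¹ : ℝ≥0∞) ^ N) atTop (nhds (4 * 0)) :=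
      ENNReal.Tendsto.const_mul
        (ENNReal.tendsto_pow_atTop_nhds_zero_of_lt_one (by simp))
        (Or.inr (by simp))
    rw [mul_zero] at ht
    exact le_antisymm (ge_of_tendsto' ht hb) bot_le
  · intro k hk
    set B : ℕ → Set Ω := fun N => toMeasurable P (Aset X N) with hB
    have hpt : ∀ ω, (Tvar X ω : ℝ≥0∞) ^ k ≤
        ∑' N : ℕ, (B N).indicator (fun _ => ((2 * N + 2 : ℕ) : ℝ≥0∞) ^ k) ω := by
      intro ω
      by_cases hne : (Tset X ω).Nonempty
      · have hm : Tvar X ω ∈ Tset X ω := Nat.sInf_mem hne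
        obtain ⟨h2, ⟨a, ha⟩, -⟩ := hm
        have hmem : ω ∈ B (a - 1) := by
          apply subset_toMeasurable
          intro t ht
          have : Tvar X ω ≤ t := Nat.sInf_le ht
          omega
        refine le_trans ?_ (ENNReal.le_tsum (a - 1))
        rw [indicator_of_mem hmem, show 2 * (a - 1) + 2 = Tvar X ω by omega]
      · have : Tvar X ω = 0 := by
          unfold Tvar
          rw [not_nonempty_iff_eq_empty.1 hne, Nat.sInf_empty]
        rw [this]
        simp [show k ≠ 0 by omega]
    calc ∫⁻ ω, (Tvar X ω : ℝ≥0∞) ^ k ∂P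
        ≤ ∫⁻ ω, ∑' N : ℕ, (B N).indicator (fun _ => ((2 * N + 2 : ℕ) : ℝ≥0∞) ^ k) ω ∂P :=
          lintegral_mono hpt
      _ = ∑' N : ℕ, ∫⁻ ω, (B N).indicator (fun _ => ((2 * N + 2 : ℕ) : ℝ≥0∞) ^ k) ω ∂P :=
          lintegral_tsum fun N =>
            (measurable_const.indicator (measurableSet_toMeasurable _ _)).aemeasurable
      _ ≤ kap k := by
          refine ENNReal.tsum_le_tsum fun N => ?_
          rw [lintegral_indicator_const (measurableSet_toMeasurable _ _), measure_toMeasurable]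
          gcongr
          exact hA N

end
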